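/- Let H be a real Hilbert space, λ ≥ 0, and let Φ : H → (−∞,+∞] be proper, λ-convex, and lower semicontinuous. Let x₀ belong to the closure of dom(Φ) and let u be a gradient flow of Φ starting at x₀. Then for every x ∈ H and every t > 0, Φ(u(t)) ≤ Φ(x) + ‖x₀ − x‖²/(2κ(t,λ)). In particular, if Φ attains a minimum at some x_* ∈ H, then Φ(u(t)) → Φ(x_*) as t → +∞. -/

import Mathlib

open Filter Topology MeasureTheory

/-- `Φ` is `λ`-convex: `Φ(tx + (1−t)y) ≤ tΦ(x) + (1−t)Φ(y) − (λ/2)t(1−t)‖x−y‖²`. -/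
def LambdaConvex {H : Type*} [NormedAddCommGroup H] [NormedSpace ℝ H]
    (l : ℝ) (Φ : H → EReal) : Prop :=
  ∀ x y : H, ∀ t : ℝ, t ∈ Set.Icc (0 : ℝ) 1 →
    Φ (t • x + (1 - t) • y) ≤
      (t : EReal) * Φ x + ((1 - t : ℝ) : EReal) * Φ y
        - (((l / 2) * t * (1 - t) * ‖x - y‖ ^ 2 : ℝ) : EReal)

open Classical in
/-- `κ(t,λ) = (e^{2λt} − 1)/(2λ)` for `λ ≠ 0`, and `κ(t,0) = t`. -/
noncomputable def kappa (t l : ℝ) : ℝ :=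
  if l = 0 then t else (Real.exp (2 * l * t) - 1) / (2 * l)

/-- A curve `u : (0,∞) → H` is *locally absolutely continuous* if there is a nonnegative
function `g`, integrable on compact subintervals of `(0,∞)`, with
`‖u(t) − u(s)‖ ≤ ∫_s^t g` for all `0 < s ≤ t`. -/
def LocAbsCont {H : Type*} [NormedAddCommGroup H] (u : ℝ → H) : Prop :=
  ∃ g : ℝ → ℝ, (∀ s ∈ Set.Ioi (0 : ℝ), 0 ≤ g s) ∧
    (∀ a b : ℝ, 0 < a → IntegrableOn g (Set.Icc a b)) ∧
    ∀ s t : ℝ, 0 < s → s ≤ t → ‖u t - u s‖ ≤ ∫ r in Set.Icc s t, g r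

/-- `u` is a gradient flow of the proper, `λ`-convex, lower-semicontinuous function `Φ` starting
at `x₀`: `u` is locally absolutely continuous on `(0,∞)`, `u(t) → x₀` as `t ↓ 0`, and the
evolution variational inequality
`(1/2)(d/dt)‖u(t) − v‖² + (λ/2)‖u(t) − v‖² + Φ(u(t)) ≤ Φ(v)` holds for every `v ∈ H` and
almost every `t > 0`. -/
def IsGradientFlow {H : Type*} [NormedAddCommGroup H] [NormedSpace ℝ H]
    (l : ℝ) (Φ : H → EReal) (x₀ : H) (u : ℝ → H) : Prop :=
  LocAbsCont u ∧
  Tendsto u (𝓝[>] (0 : ℝ)) (𝓝 x₀) ∧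
  ∀ v : H, ∀ᵐ t ∂(volume.restrict (Set.Ioi (0 : ℝ))), ∃ d : ℝ,
    HasDerivAt (fun s => ‖u s - v‖ ^ 2 / 2) d t ∧
    (d : EReal) + (((l / 2) * ‖u t - v‖ ^ 2 : ℝ) : EReal) + Φ (u t) ≤ Φ v

/-! ### Absolutely continuous functions with a sign condition on the derivative -/

theorem AbsolutelyContinuousOnInterval.of_dist_le {X Y : Type*} [PseudoMetricSpace X]
    [PseudoMetricSpace Y] {f : ℝ → X} {g : ℝ → Y} {a b : ℝ}
    (hg : AbsolutelyContinuousOnInterval g a b)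
    (h : ∀ x ∈ Set.uIcc a b, ∀ y ∈ Set.uIcc a b, dist (f x) (f y) ≤ dist (g x) (g y)) :
    AbsolutelyContinuousOnInterval f a b := by
  refine squeeze_zero' (.of_forall fun E => Finset.sum_nonneg fun _ _ => dist_nonneg) ?_ hg
  filter_upwards [Filter.mem_inf_of_right (mem_principal_self _)] with E hE
  exact Finset.sum_le_sum fun i hi => h _ (hE.1 i hi).1 _ (hE.1 i hi).2

theorem AbsolutelyContinuousOnInterval.le_of_ae_deriv_nonpos {f : ℝ → ℝ} {a b : ℝ} (hab : a ≤ b)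
    (hf : AbsolutelyContinuousOnInterval f a b)
    (h : ∀ᵐ x ∂volume.restrict (Set.Ioc a b), deriv f x ≤ 0) : f b ≤ f a := by
  have := hf.integral_deriv_eq_sub
  rw [intervalIntegral.integral_of_le hab] at this
  linarith [integral_nonpos_of_ae h]

theorem AbsolutelyContinuousOnInterval.lt_of_ae_deriv_neg {f : ℝ → ℝ} {a b : ℝ} (hab : a < b)
    (hf : AbsolutelyContinuousOnInterval f a b)
    (h : ∀ᵐ x ∂volume.restrict (Set.Ioc a b), deriv f x < 0) : f b < f a := by
  have hi : IntegrableOn (fun x => -deriv f x) (Set.Ioc a b) :=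
    (hf.intervalIntegrable_deriv.neg).1
  have hpos : 0 < ∫ x in Set.Ioc a b, -deriv f x := by
    rw [integral_pos_iff_support_of_nonneg_ae
      (h.mono fun x hx => by simpa using hx.le) hi]
    have : (volume.restrict (Set.Ioc a b)) (Function.support fun x => -deriv f x) =
        (volume.restrict (Set.Ioc a b)) Set.univ :=
      measure_congr (eventuallyEq_univ.2 (h.mono fun x hx => by simpa using hx.ne))
    rw [this]
    simpa using hab
  have := hf.integral_deriv_eq_sub
  rw [intervalIntegral.integral_of_le hab.le] at this
  rw [integral_neg] at hpos
  linarith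

/-! ### The function `kappa` -/

theorem mul_kappa (t l : ℝ) : 2 * l * kappa t l = Real.exp (2 * l * t) - 1 := by
  unfold kappa
  split_ifs with h
  · simp [h]
  · field_simp

theorem hasDerivAt_kappa (t l : ℝ) :
    HasDerivAt (fun s => kappa s l) (Real.exp (2 * l * t)) t := by
  unfold kappa
  split_ifs with h
  · simpa [h] using! hasDerivAt_id t
  · have := (((hasDerivAt_id t).const_mul (2 * l)).exp.sub_const 1).div_const (2 * l)
    convert! this using 1
    simp only [id]
    field_simp

theorem contDiff_kappa (l : ℝ) : ContDiff ℝ 1 (fun s => kappa s l) := by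
  unfold kappa
  split_ifs with h <;> fun_prop

theorem kappa_zero_left (l : ℝ) : kappa 0 l = 0 := by
  simp [kappa]

theorem le_kappa {t l : ℝ} (hl : 0 ≤ l) : t ≤ kappa t l := by
  unfold kappa
  split_ifs with h
  · rfl
  · have hl' : 0 < 2 * l := by positivity
    rw [le_div_iff₀ hl']
    linarith [Real.add_one_le_exp (2 * l * t)]

theorem kappa_neg_sub (l s t : ℝ) : kappa t (-l / 2) - kappa s (-l / 2) =
    Real.exp (-(l * (s + t))) * (kappa t (l / 2) - kappa s (l / 2)) := by
  rcases eq_or_ne l 0 with rfl | h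
  · simp [kappa]
  · have h1 := mul_kappa t (-l / 2)
    have h2 := mul_kappa s (-l / 2)
    have h3 := mul_kappa t (l / 2)
    have h4 := mul_kappa s (l / 2)
    have e1 : Real.exp (-(l * (s + t))) * Real.exp (2 * (l / 2) * t) =
        Real.exp (2 * (-l / 2) * s) := by rw [← Real.exp_add]; ring_nf
    have e2 : Real.exp (-(l * (s + t))) * Real.exp (2 * (l / 2) * s) =
        Real.exp (2 * (-l / 2) * t) := by rw [← Real.exp_add]; ring_nf
    apply mul_left_cancel₀ h
    linear_combination -h1 + h2 - Real.exp (-(l * (s + t))) * (h3 - h4) - e1 + e2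

theorem kappa_le_exp_mul_kappa_neg {t l : ℝ} (hl : 0 ≤ l) :
    kappa t l ≤ Real.exp (2 * l * t) * kappa t (-l / 2) := by
  rcases hl.eq_or_lt with rfl | h
  · simp [kappa]
  · have h1 := mul_kappa t (-l / 2)
    have h2 := mul_kappa t l
    have e1 : Real.exp (2 * l * t) = Real.exp (l * t) ^ 2 := by
      rw [← Real.exp_nat_mul]; ring_nf
    have e2 : Real.exp (2 * (-l / 2) * t) * Real.exp (l * t) = 1 := by
      rw [← Real.exp_add]; ring_nf; simp
    have hl' : 0 < 2 * l := by positivity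
    refine le_of_mul_le_mul_left ?_ hl'
    rw [h2, e1]
    have h3 : 2 * l * (Real.exp (l * t) ^ 2 * kappa t (-l / 2)) =
        2 * Real.exp (l * t) ^ 2 - 2 * Real.exp (l * t) := by
      linear_combination (-2 * Real.exp (l * t) ^ 2) * h1 - 2 * Real.exp (l * t) * e2
    rw [h3]
    nlinarith [sq_nonneg (Real.exp (l * t) - 1)]

/-! ### Consequences of the evolution variational inequality -/

section GradientFlow

variable {H : Type*} [NormedAddCommGroup H]

theorem LocAbsCont.absolutelyContinuousOnInterval {u : ℝ → H} (hu : LocAbsCont u) {a b : ℝ}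
    (ha : 0 < a) (hab : a ≤ b) : AbsolutelyContinuousOnInterval u a b := by
  obtain ⟨g, -, hgi, hgu⟩ := hu
  have hint : IntervalIntegrable g volume a b := by
    rw [intervalIntegrable_iff_integrableOn_Icc_of_le hab]
    exact hgi a b ha
  have key : ∀ x ∈ Set.Icc a b, ∀ y ∈ Set.Icc a b, x ≤ y →
      dist (u x) (u y) ≤ dist (∫ r in a..x, g r) (∫ r in a..y, g r) := by
    intro x hx y hy hxy
    have hx' : IntervalIntegrable g volume a x :=
      hint.mono_set (by rw [Set.uIcc_of_le hab, Set.uIcc_of_le hx.1]; gcongr; exact hx.2)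
    have hy' : IntervalIntegrable g volume a y :=
      hint.mono_set (by rw [Set.uIcc_of_le hab, Set.uIcc_of_le hy.1]; gcongr; exact hy.2)
    rw [dist_comm, dist_eq_norm, dist_comm, Real.dist_eq,
      intervalIntegral.integral_interval_sub_left hy' hx', intervalIntegral.integral_of_le hxy,
      ← integral_Icc_eq_integral_Ioc]
    exact (hgu x y (ha.trans_le hx.1) hxy).trans (le_abs_self _)
  refine (hint.absolutelyContinuousOnInterval_intervalIntegral
    Set.left_mem_uIcc).of_dist_le fun x hx y hy => ?_
  rw [Set.uIcc_of_le hab] at hx hy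
  rcases le_total x y with h | h
  · exact key x hx y hy h
  · rw [dist_comm, dist_comm (∫ r in a..x, g r)]
    exact key y hy x hx h

theorem LocAbsCont.absolutelyContinuousOnInterval_exp_mul_add {u : ℝ → H} (hu : LocAbsCont u)
    {a b : ℝ} (ha : 0 < a) (hab : a ≤ b) (w : H) (l : ℝ) {ψ : ℝ → ℝ} (hψ : ContDiff ℝ 1 ψ) :
    AbsolutelyContinuousOnInterval
      (fun r => Real.exp (l * r) * (‖u r - w‖ ^ 2 / 2) + ψ r) a b := by
  have hn : AbsolutelyContinuousOnInterval (fun r => ‖u r - w‖) a b :=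
    (hu.absolutelyContinuousOnInterval ha hab).of_dist_le fun x _ y _ => by
      rw [Real.dist_eq, dist_eq_norm]
      simpa using abs_norm_sub_norm_le (u x - w) (u y - w)
  have he : ContDiff ℝ 1 (fun r : ℝ => Real.exp (l * r)) := by fun_prop
  have := ((he.contDiffOn (s := Set.uIcc a b)).absolutelyContinuousOnInterval.fun_mul
    ((hn.fun_mul hn).const_mul (1 / 2))).fun_add
    (hψ.contDiffOn (s := Set.uIcc a b)).absolutelyContinuousOnInterval
  convert! this using 3
  ring

theorem hasDerivAt_exp_mul_add {u : ℝ → H} {v : H} {l d t ψ' : ℝ} {ψ : ℝ → ℝ}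
    (hd : HasDerivAt (fun s => ‖u s - v‖ ^ 2 / 2) d t) (hψ : HasDerivAt ψ ψ' t) :
    HasDerivAt (fun r => Real.exp (l * r) * (‖u r - v‖ ^ 2 / 2) + ψ r)
      (Real.exp (l * t) * (d + l / 2 * ‖u t - v‖ ^ 2) + ψ') t := by
  have := ((((hasDerivAt_id t).const_mul l).exp).mul hd).add hψ
  convert! this using 1
  simp only [id]
  ring

variable [InnerProductSpace ℝ H] {l : ℝ} {Φ : H → EReal} {x₀ : H} {u : ℝ → H}

theorem IsGradientFlow.ae_evi (hbot : ∀ x, Φ x ≠ ⊥) (hu : IsGradientFlow l Φ x₀ u) {v : H}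
    (hv : Φ v ≠ ⊤) : ∀ᵐ t ∂volume.restrict (Set.Ioi (0 : ℝ)), Φ (u t) ≠ ⊤ ∧ ∃ d : ℝ,
      HasDerivAt (fun s => ‖u s - v‖ ^ 2 / 2) d t ∧
      d + l / 2 * ‖u t - v‖ ^ 2 + (Φ (u t)).toReal ≤ (Φ v).toReal := by
  filter_upwards [hu.2.2 v] with t ⟨d, hd, h⟩
  rw [← EReal.coe_add] at h
  have ht : Φ (u t) ≠ ⊤ := by
    intro ht
    rw [ht, EReal.coe_add_top, top_le_iff] at h
    exact hv h
  refine ⟨ht, d, hd, ?_⟩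
  rw [← EReal.coe_toReal ht (hbot _), ← EReal.coe_toReal hv (hbot _)] at h
  exact_mod_cast h

theorem LambdaConvex.toReal_le (hbot : ∀ x, Φ x ≠ ⊥) (hconv : LambdaConvex l Φ) {x y : H}
    (hx : Φ x ≠ ⊤) (hy : Φ y ≠ ⊤) {t : ℝ} (ht : t ∈ Set.Icc (0 : ℝ) 1) :
    Φ (t • x + (1 - t) • y) ≠ ⊤ ∧ (Φ (t • x + (1 - t) • y)).toReal ≤
      t * (Φ x).toReal + (1 - t) * (Φ y).toReal - l / 2 * t * (1 - t) * ‖x - y‖ ^ 2 := by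
  have h := hconv x y t ht
  rw [← EReal.coe_toReal hx (hbot _), ← EReal.coe_toReal hy (hbot _), ← EReal.coe_mul,
    ← EReal.coe_mul, ← EReal.coe_add, ← EReal.coe_sub] at h
  have hne := ne_top_of_le_ne_top (EReal.coe_ne_top _) h
  refine ⟨hne, ?_⟩
  rw [← EReal.coe_toReal hne (hbot _)] at h
  exact_mod_cast h

theorem IsGradientFlow.exists_le_exp_decay (hl : 0 ≤ l) (hbot : ∀ x, Φ x ≠ ⊥)
    (hconv : LambdaConvex l Φ) (hu : IsGradientFlow l Φ x₀ u) {v : H} (hv : Φ v ≠ ⊤) {s b : ℝ}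
    (hs : 0 < s) (hsb : s < b) (hus : Φ (u s) ≠ ⊤) :
    ∃ r ∈ Set.Ioc s b, Φ (u r) ≤ (((Φ v).toReal +
      Real.exp (-(2 * l * (r - s))) * ((Φ (u s)).toReal - (Φ v).toReal) : ℝ) : EReal) := by
  by_contra! hcon
  set F : ℝ := (Φ (u s)).toReal - (Φ v).toReal with hF
  set q : ℝ := Real.exp (-(l * (b - s))) with hq
  have hq1 : q ≤ 1 := Real.exp_le_one_iff.2 (by nlinarith)
  obtain ⟨hw, hwle⟩ := hconv.toReal_le hbot hus hv (t := q) ⟨(Real.exp_pos _).le, hq1⟩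
  set w : H := q • u s + (1 - q) • v with hwdef
  have hψ : ContDiff ℝ 1 (fun r => F * Real.exp (2 * l * s) * kappa r (-l / 2) -
      ((Φ w).toReal - (Φ v).toReal) * kappa r (l / 2)) :=
    (contDiff_const.mul (contDiff_kappa _)).sub (contDiff_const.mul (contDiff_kappa _))
  have hlt := (hu.1.absolutelyContinuousOnInterval_exp_mul_add hs hsb.le w l
    hψ).lt_of_ae_deriv_neg hsb (by
      have hevi := ae_restrict_of_ae_restrict_of_subset
        (Set.Ioc_subset_Ioi_self.trans (Set.Ioi_subset_Ioi hs.le) : Set.Ioc s b ⊆ _)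
        (hu.ae_evi hbot hw)
      filter_upwards [hevi, ae_restrict_mem measurableSet_Ioc] with r ⟨hr, d, hd, hle⟩ hrm
      rw [(hasDerivAt_exp_mul_add hd (((hasDerivAt_kappa r _).const_mul _).fun_sub
        ((hasDerivAt_kappa r _).const_mul _))).deriv]
      have h := hcon r hrm
      rw [← EReal.coe_toReal hr (hbot _), EReal.coe_lt_coe_iff] at h
      have e1 : Real.exp (2 * (l / 2) * r) = Real.exp (l * r) := by ring_nf
      have e2 : Real.exp (2 * l * s) * Real.exp (2 * (-l / 2) * r) =
          Real.exp (l * r) * Real.exp (-(2 * l * (r - s))) := by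
        rw [← Real.exp_add, ← Real.exp_add]; ring_nf
      rw [e1, mul_assoc, e2]
      have : Real.exp (l * r) * (d + l / 2 * ‖u r - w‖ ^ 2 +
        Real.exp (-(2 * l * (r - s))) * F - ((Φ w).toReal - (Φ v).toReal)) < 0 :=
        mul_neg_of_pos_of_neg (Real.exp_pos _) (by linarith)
      linarith)
  have hK : Real.exp (2 * l * s) * (kappa b (-l / 2) - kappa s (-l / 2)) =
      q * (kappa b (l / 2) - kappa s (l / 2)) := by
    rw [kappa_neg_sub, ← mul_assoc, ← Real.exp_add, hq]
    ring_nf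
  have hΔ : q * (l * (kappa b (l / 2) - kappa s (l / 2))) = Real.exp (l * s) * (1 - q) := by
    have h1 := mul_kappa b (l / 2)
    have h2 := mul_kappa s (l / 2)
    have e1 : q * Real.exp (l * b) = Real.exp (l * s) := by
      rw [hq, ← Real.exp_add]; ring_nf
    rw [show 2 * (l / 2) * b = l * b by ring] at h1
    rw [show 2 * (l / 2) * s = l * s by ring] at h2
    linear_combination q * (h1 - h2) + e1
  have hΔ0 : 0 ≤ kappa b (l / 2) - kappa s (l / 2) := sub_nonneg.2 <|
    (monotone_of_deriv_nonneg ((contDiff_kappa _).differentiable one_ne_zero) fun r => by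
      rw [(hasDerivAt_kappa r _).deriv]; positivity) hsb.le
  have hdist : ‖u s - w‖ ^ 2 = (1 - q) ^ 2 * ‖u s - v‖ ^ 2 := by
    rw [show u s - w = (1 - q) • (u s - v) by rw [hwdef]; module, norm_smul, mul_pow,
      Real.norm_eq_abs, sq_abs]
  have hN : 0 ≤ Real.exp (l * b) * (‖u b - w‖ ^ 2 / 2) := by positivity
  have hconvΔ := mul_le_mul_of_nonneg_right hwle hΔ0
  simp only [hdist] at hlt
  have hΔ' := congrArg (fun z => z * ((1 - q) * ‖u s - v‖ ^ 2 / 2)) hΔ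
  have hK' := congrArg (fun z => F * z) hK
  rw [hF] at hlt hK'
  nlinarith

theorem IsGradientFlow.le_exp_decay (hl : 0 ≤ l) (hbot : ∀ x, Φ x ≠ ⊥)
    (hconv : LambdaConvex l Φ) (hlsc : LowerSemicontinuous Φ) (hu : IsGradientFlow l Φ x₀ u)
    {v : H} (hv : Φ v ≠ ⊤) {s b : ℝ} (hs : 0 < s) (hsb : s ≤ b) (hus : Φ (u s) ≠ ⊤) :
    Φ (u b) ≤ (((Φ v).toReal +
      Real.exp (-(2 * l * (b - s))) * ((Φ (u s)).toReal - (Φ v).toReal) : ℝ) : EReal) := by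
  set c : ℝ → ℝ := fun r => (Φ v).toReal +
      Real.exp (-(2 * l * (r - s))) * ((Φ (u s)).toReal - (Φ v).toReal) with hc
  have hcont : ContinuousOn u (Set.Icc s b) := by
    simpa [Set.uIcc_of_le hsb] using (hu.1.absolutelyContinuousOnInterval hs hsb).continuousOn
  have hcc : Continuous c := by fun_prop
  have hclosed : IsClosed ({r | Φ (u r) ≤ (c r : EReal)} ∩ Set.Icc s b) := by
    rw [Set.inter_comm]
    exact (hcont.prodMk (continuous_coe_real_ereal.comp hcc).continuousOn)
      |>.preimage_isClosed_of_isClosed isClosed_Icc hlsc.isClosed_epigraph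
  refine hclosed.mem_of_ge_of_forall_exists_gt (a := s) (b := b) ?_ hsb ?_
  · refine (EReal.coe_toReal hus (hbot _)).ge.trans (EReal.coe_le_coe_iff.2 ?_)
    simp [hc]
  · rintro x ⟨hx : Φ (u x) ≤ (c x : EReal), hxs, hxb⟩
    have hxt : Φ (u x) ≠ ⊤ := ne_top_of_le_ne_top (EReal.coe_ne_top _) hx
    obtain ⟨r, hr, hle⟩ :=
      hu.exists_le_exp_decay hl hbot hconv hv (hs.trans_le hxs) hxb hxt
    refine ⟨r, hle.trans ?_, hr⟩
    rw [← EReal.coe_toReal hxt (hbot _), EReal.coe_le_coe_iff] at hx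
    rw [EReal.coe_le_coe_iff]
    have e : Real.exp (-(2 * l * (r - s))) =
        Real.exp (-(2 * l * (r - x))) * Real.exp (-(2 * l * (x - s))) := by
      rw [← Real.exp_add]; ring_nf
    simp only [hc, e] at hx ⊢
    have := mul_le_mul_of_nonneg_left (sub_le_iff_le_add'.2 hx)
      (Real.exp_pos (-(2 * l * (r - x)))).le
    linarith

theorem IsGradientFlow.apply_ne_top (hl : 0 ≤ l) (hbot : ∀ x, Φ x ≠ ⊥)
    (hconv : LambdaConvex l Φ) (hlsc : LowerSemicontinuous Φ) (hu : IsGradientFlow l Φ x₀ u)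
    {v : H} (hv : Φ v ≠ ⊤) {t : ℝ} (ht : 0 < t) : Φ (u t) ≠ ⊤ := by
  have hevi := ae_restrict_of_ae_restrict_of_subset
    (Set.Ioo_subset_Ioi_self : Set.Ioo 0 t ⊆ _) (hu.ae_evi hbot hv)
  have : (ae (volume.restrict (Set.Ioo 0 t))).NeBot := by
    rw [ae_neBot, Ne, Measure.restrict_eq_zero]
    simpa using ht
  obtain ⟨s, ⟨hs, -⟩, hst⟩ := (hevi.and (ae_restrict_mem measurableSet_Ioo)).exists
  exact ne_top_of_le_ne_top (EReal.coe_ne_top _)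
    (hu.le_exp_decay hl hbot hconv hlsc hv hst.1 hst.2.le hs)

theorem IsGradientFlow.sub_mul_exp_mul_kappa_le (hl : 0 ≤ l) (hbot : ∀ x, Φ x ≠ ⊥)
    (hconv : LambdaConvex l Φ) (hlsc : LowerSemicontinuous Φ) (hu : IsGradientFlow l Φ x₀ u)
    {v : H} (hv : Φ v ≠ ⊤) {t : ℝ} (ht : 0 < t) :
    ((Φ (u t)).toReal - (Φ v).toReal) * Real.exp (2 * l * t) * kappa t (-l / 2) ≤
      ‖x₀ - v‖ ^ 2 / 2 := by
  have hut := hu.apply_ne_top hl hbot hconv hlsc hv ht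
  set F : ℝ := (Φ (u t)).toReal - (Φ v).toReal with hF
  have hψ : ContDiff ℝ 1 (fun r => F * Real.exp (2 * l * t) * kappa r (-l / 2)) :=
    contDiff_const.mul (contDiff_kappa _)
  have hmono : ∀ s ∈ Set.Ioc 0 t, F * Real.exp (2 * l * t) * kappa t (-l / 2) ≤
      Real.exp (l * s) * (‖u s - v‖ ^ 2 / 2) +
        F * Real.exp (2 * l * t) * kappa s (-l / 2) := by
    intro s hs
    have hle := (hu.1.absolutelyContinuousOnInterval_exp_mul_add hs.1 hs.2 v l
      hψ).le_of_ae_deriv_nonpos hs.2 (by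
        have hevi := ae_restrict_of_ae_restrict_of_subset
          (Set.Ioc_subset_Ioi_self.trans (Set.Ioi_subset_Ioi hs.1.le) : Set.Ioc s t ⊆ _)
          (hu.ae_evi hbot hv)
        filter_upwards [hevi, ae_restrict_mem measurableSet_Ioc] with r ⟨hr, d, hd, hle⟩ hrm
        rw [(hasDerivAt_exp_mul_add hd ((hasDerivAt_kappa r _).const_mul _)).deriv]
        have h := hu.le_exp_decay hl hbot hconv hlsc hv (hs.1.trans hrm.1) hrm.2 hr
        rw [← EReal.coe_toReal hut (hbot _), EReal.coe_le_coe_iff, ← sub_le_iff_le_add',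
          ← hF] at h
        have e1 : Real.exp (2 * l * t) * Real.exp (2 * (-l / 2) * r) =
            Real.exp (l * r) * Real.exp (2 * l * (t - r)) := by
          rw [← Real.exp_add, ← Real.exp_add]; ring_nf
        have h' : Real.exp (2 * l * (t - r)) * F ≤ (Φ (u r)).toReal - (Φ v).toReal := by
          rwa [Real.exp_neg, inv_mul_eq_div, le_div_iff₀' (Real.exp_pos _)] at h
        rw [mul_assoc, e1]
        have : Real.exp (l * r) * (d + l / 2 * ‖u r - v‖ ^ 2 +
            Real.exp (2 * l * (t - r)) * F) ≤ 0 :=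
          mul_nonpos_of_nonneg_of_nonpos (Real.exp_pos _).le (by linarith)
        linarith)
    have hN : 0 ≤ Real.exp (l * t) * (‖u t - v‖ ^ 2 / 2) := by positivity
    linarith
  have hlim : Tendsto (fun s => Real.exp (l * s) * (‖u s - v‖ ^ 2 / 2) +
      F * Real.exp (2 * l * t) * kappa s (-l / 2)) (𝓝[>] 0) (𝓝 (‖x₀ - v‖ ^ 2 / 2)) := by
    have h1 : Tendsto (fun s => Real.exp (l * s)) (𝓝[>] 0) (𝓝 (Real.exp (l * 0))) :=
      ((by fun_prop : Continuous fun s => Real.exp (l * s)).tendsto 0).mono_left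
        nhdsWithin_le_nhds
    have h2 := (hψ.continuous.tendsto 0).mono_left (nhdsWithin_le_nhds (s := Set.Ioi 0))
    have h3 := (h1.mul (((hu.2.1.sub_const v).norm.pow 2).div_const 2)).add h2
    simpa [kappa_zero_left] using h3
  exact ge_of_tendsto hlim (by
    filter_upwards [Ioc_mem_nhdsGT ht] with s hs using hmono s hs)

theorem IsGradientFlow.apply_le_add (hl : 0 ≤ l) (hbot : ∀ x, Φ x ≠ ⊥)
    (hconv : LambdaConvex l Φ) (hlsc : LowerSemicontinuous Φ) (hu : IsGradientFlow l Φ x₀ u)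
    (x : H) {t : ℝ} (ht : 0 < t) :
    Φ (u t) ≤ Φ x + ((‖x₀ - x‖ ^ 2 / (2 * kappa t l) : ℝ) : EReal) := by
  by_cases hx : Φ x = ⊤
  · simp [hx]
  have hut := hu.apply_ne_top hl hbot hconv hlsc hx ht
  have hκ : 0 < kappa t l := ht.trans_le (le_kappa hl)
  have key := hu.sub_mul_exp_mul_kappa_le hl hbot hconv hlsc hx ht
  rw [← EReal.coe_toReal hut (hbot _), ← EReal.coe_toReal hx (hbot _), ← EReal.coe_add,
    EReal.coe_le_coe_iff, ← sub_le_iff_le_add']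
  rcases le_total ((Φ (u t)).toReal - (Φ x).toReal) 0 with hF | hF
  · exact hF.trans (by positivity)
  · rw [le_div_iff₀ (by positivity)]
    have := mul_le_mul_of_nonneg_left (kappa_le_exp_mul_kappa_neg (t := t) hl) hF
    linarith

end GradientFlow

/-- Let `λ ≥ 0` and let `Φ : H → (−∞,+∞]` be proper, `λ`-convex and lower
semicontinuous on a real Hilbert space; let `x₀` belong to the closure of `dom Φ` and let `u` be
a gradient flow of `Φ` starting at `x₀`. Then for every `x ∈ H` and `t > 0`,
`Φ(u(t)) ≤ Φ(x) + ‖x₀ − x‖²/(2κ(t,λ))`; in particular, if `Φ` attains a minimum at `x_*`, then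
`Φ(u(t)) → Φ(x_*)` as `t → +∞`. -/
theorem gradientFlow_decay {H : Type*} [NormedAddCommGroup H]
    [InnerProductSpace ℝ H] [CompleteSpace H] (l : ℝ) (hl : 0 ≤ l) (Φ : H → EReal)
    (hbot : ∀ x, Φ x ≠ ⊥) (hproper : ∃ x, Φ x ≠ ⊤)
    (hconv : LambdaConvex l Φ) (hlsc : LowerSemicontinuous Φ)
    (x₀ : H) (hx₀ : x₀ ∈ closure {x : H | Φ x ≠ ⊤})
    (u : ℝ → H) (hu : IsGradientFlow l Φ x₀ u) :
    (∀ x : H, ∀ t : ℝ, 0 < t →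
      Φ (u t) ≤ Φ x + ((‖x₀ - x‖ ^ 2 / (2 * kappa t l) : ℝ) : EReal)) ∧
    (∀ xstar : H, (∀ x : H, Φ xstar ≤ Φ x) →
      Tendsto (fun t => Φ (u t)) atTop (𝓝 (Φ xstar))) := by
  refine ⟨fun x t ht => hu.apply_le_add hl hbot hconv hlsc x ht, fun xstar hmin => ?_⟩
  have hκ : Tendsto (fun t => 2 * kappa t l) atTop atTop :=
    (tendsto_atTop_mono (fun t => le_kappa hl) tendsto_id).const_mul_atTop two_pos
  have hstar : Φ xstar ≠ ⊤ := by
    obtain ⟨y, hy⟩ := hproper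
    exact ne_top_of_le_ne_top hy (hmin y)
  have hlim : Tendsto (fun t => Φ xstar + ((‖x₀ - xstar‖ ^ 2 / (2 * kappa t l) : ℝ) : EReal))
      atTop (𝓝 (Φ xstar)) := by
    rw [← EReal.coe_toReal hstar (hbot _)]
    simp only [← EReal.coe_add]
    refine (continuous_coe_real_ereal.tendsto _).comp ?_
    simpa using (hκ.const_div_atTop (‖x₀ - xstar‖ ^ 2)).const_add (Φ xstar).toReal
  refine tendsto_of_tendsto_of_tendsto_of_le_of_le' tendsto_const_nhds hlim
    (.of_forall fun t => hmin _) ?_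
  filter_upwards [eventually_gt_atTop 0] with t ht
  exact hu.apply_le_add hl hbot hconv hlsc xstar ht
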